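/- arXiv:1909.01659 — 2 statements merged into one kernel-verified Lean document; each statement's English description precedes it below -/
import Mathlib

section
/- For every natural number k, ∫_0^4 x^k / (π·√(x(4−x))) dx = C(2k, k), the central binomial coefficient. (This computes the special values ζ_ℤ(−k) = C(2k,k) of the spectral zeta function of the lattice ℤ at negative integers; in particular ζ_ℤ(−k)/(k+1) is the k-th Catalan number.) -/
open Real MeasureTheory

theorem four_pow_mul_prod_eq_centralBinom (k : ℕ) :
    (4 : ℝ) ^ k * ∏ i ∈ Finset.range k, (2 * (i : ℝ) + 1) / (2 * i + 2) = k.centralBinom := by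
  induction k with
  | zero => simp
  | succ k ih =>
    have h : ((k : ℝ) + 1) * (k + 1).centralBinom = 2 * (2 * k + 1) * k.centralBinom := by
      exact_mod_cast Nat.succ_mul_centralBinom_succ k
    rw [Finset.prod_range_succ, pow_succ]
    rw [← ih] at h
    apply mul_left_cancel₀ (by positivity : (k : ℝ) + 1 ≠ 0)
    rw [h]
    field_simp
    ring

theorem image_four_mul_cos_sq :
    (fun t : ℝ => 4 * cos t ^ 2) '' Set.Ioo 0 (π / 2) = Set.Ioo 0 4 := by
  ext x
  constructor
  · rintro ⟨t, ⟨h0, h1⟩, rfl⟩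
    have hc : 0 < cos t := cos_pos_of_mem_Ioo ⟨by linarith, h1⟩
    have hs : 0 < sin t := sin_pos_of_pos_of_lt_pi h0 (by linarith)
    constructor
    · positivity
    · nlinarith [sin_sq_add_cos_sq t, mul_pos hs hs]
  · rintro ⟨h0, h4⟩
    have hp : 0 < √(x / 4) := Real.sqrt_pos.2 (by linarith)
    have hlt : √(x / 4) < 1 := by
      rw [Real.sqrt_lt' one_pos]
      linarith
    refine ⟨arccos √(x / 4), ⟨arccos_pos.2 hlt, arccos_lt_pi_div_two.2 hp⟩, ?_⟩
    simp only
    rw [cos_arccos (by linarith) hlt.le, Real.sq_sqrt (by linarith)]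
    ring

theorem injOn_four_mul_cos_sq :
    Set.InjOn (fun t : ℝ => 4 * cos t ^ 2) (Set.Ioo 0 (π / 2)) := by
  intro a ha b hb h
  have hca : 0 < cos a := cos_pos_of_mem_Ioo ⟨by linarith [ha.1, pi_pos], ha.2⟩
  have hcb : 0 < cos b := cos_pos_of_mem_Ioo ⟨by linarith [hb.1, pi_pos], hb.2⟩
  have hab : cos a ^ 2 = cos b ^ 2 := by simp only at h; linarith
  exact injOn_cos ⟨ha.1.le, by linarith [ha.2, pi_pos]⟩ ⟨hb.1.le, by linarith [hb.2, pi_pos]⟩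
    ((sq_eq_sq₀ hca.le hcb.le).1 hab)

/-- The special values of the spectral zeta function of `ℤ` at negative integers:
`ζ_ℤ(−k) = ∫_0^4 x^k/(π√(x(4−x))) dx = C(2k,k)`, the central binomial coefficient. -/
theorem zeta_Z_neg_int (k : ℕ) :
    ∫ x in Set.Ioo (0 : ℝ) 4, x ^ k / (π * Real.sqrt (x * (4 - x)))
      = ((2 * k).choose k : ℝ) := by
  have hderiv : ∀ t ∈ Set.Ioo 0 (π / 2),
      HasDerivWithinAt (fun t : ℝ => 4 * cos t ^ 2) (-(8 * cos t * sin t))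
        (Set.Ioo 0 (π / 2)) t := fun t _ => by
    have h := ((hasDerivAt_cos t).pow 2).const_mul 4
    refine (h.congr_deriv ?_).hasDerivWithinAt
    push_cast
    ring
  have hintegrand : ∀ t ∈ Set.Ioo 0 (π / 2),
      |-(8 * cos t * sin t)| • ((4 * cos t ^ 2) ^ k /
        (π * √(4 * cos t ^ 2 * (4 - 4 * cos t ^ 2)))) =
      2 * 4 ^ k / π * cos t ^ (2 * k) := by
    rintro t ⟨h0, h1⟩
    have hc : 0 < cos t := cos_pos_of_mem_Ioo ⟨by linarith, h1⟩
    have hs : 0 < sin t := sin_pos_of_pos_of_lt_pi h0 (by linarith)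
    have hsqrt : √(4 * cos t ^ 2 * (4 - 4 * cos t ^ 2)) = 4 * cos t * sin t := by
      rw [Real.sqrt_eq_iff_mul_self_eq_of_pos (by positivity)]
      linear_combination 16 * cos t ^ 2 * sin_sq_add_cos_sq t
    rw [hsqrt, abs_neg, abs_of_pos (by positivity), smul_eq_mul, mul_pow, ← pow_mul]
    field_simp
    norm_num
  rw [← image_four_mul_cos_sq, integral_image_eq_integral_abs_deriv_smul measurableSet_Ioo hderiv
    injOn_four_mul_cos_sq, setIntegral_congr_fun measurableSet_Ioo hintegrand,
    integral_const_mul, ← integral_Ioc_eq_integral_Ioo,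
    ← intervalIntegral.integral_of_le (by positivity), EulerSine.integral_cos_pow_eq,
    integral_sin_pow_even, ← Nat.centralBinom_eq_two_mul_choose, ← four_pow_mul_prod_eq_centralBinom]
  field_simp
end

section
/- For every real number t, the heat function of ℤ satisfies ∫_0^4 e^{−tx} / (π·√(x(4−x))) dx = e^{−2t} · ∑_{n=0}^∞ t^{2n}/(n!)², where the series on the right (which equals the modified Bessel function I_0(2t)) converges for all t. -/
open Real MeasureTheory

open Set in
theorem image_two_sub_two_mul_cos_Ioo :
    (fun θ : ℝ => 2 - 2 * Real.cos θ) '' Ioo 0 π = Ioo 0 4 := by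
  ext x
  constructor
  · rintro ⟨θ, ⟨h0, hπ⟩, rfl⟩
    have h1 := Real.strictAntiOn_cos ⟨le_rfl, pi_pos.le⟩ ⟨h0.le, hπ.le⟩ h0
    have h2 := Real.strictAntiOn_cos ⟨h0.le, hπ.le⟩ ⟨pi_pos.le, le_rfl⟩ hπ
    rw [Real.cos_zero] at h1
    rw [Real.cos_pi] at h2
    constructor <;> dsimp only <;> linarith
  · rintro ⟨h0, h4⟩
    refine ⟨Real.arccos (1 - x / 2), ⟨Real.arccos_pos.2 (by linarith), ?_⟩, ?_⟩
    · refine lt_of_le_of_ne (Real.arccos_le_pi _) fun h => ?_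
      have := Real.arccos_eq_pi.1 h
      linarith
    · dsimp only
      rw [Real.cos_arccos (by linarith) (by linarith)]
      ring

/-- Substitution `x = 2 - 2 cos θ` in integrals against the arcsine law on `[0, 4]`. -/
theorem integral_div_pi_mul_sqrt_eq_integral_cos (g : ℝ → ℝ) :
    ∫ x in Set.Ioo (0 : ℝ) 4, g x / (π * Real.sqrt (x * (4 - x)))
      = (∫ θ in (0 : ℝ)..π, g (2 - 2 * Real.cos θ)) / π := by
  rw [← image_two_sub_two_mul_cos_Ioo,
    integral_image_eq_integral_abs_deriv_smul (f' := fun θ => 2 * Real.sin θ) measurableSet_Ioo,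
    intervalIntegral.integral_of_le pi_pos.le, integral_Ioc_eq_integral_Ioo, ← integral_div]
  · refine setIntegral_congr_fun measurableSet_Ioo fun θ hθ => ?_
    have hs : 0 < Real.sin θ := Real.sin_pos_of_mem_Ioo hθ
    have hsq : (2 - 2 * Real.cos θ) * (4 - (2 - 2 * Real.cos θ)) = (2 * Real.sin θ) ^ 2 := by
      linear_combination (-4) * Real.sin_sq_add_cos_sq θ
    simp only [hsq, smul_eq_mul]
    rw [Real.sqrt_sq (by positivity), abs_of_pos (by positivity)]
    field_simp
  · intro θ _
    have h := ((Real.hasDerivAt_cos θ).const_mul 2).const_sub 2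
    exact (h.congr_deriv (by ring)).hasDerivWithinAt
  · intro a ha b hb hab
    refine Real.injOn_cos (Set.Ioo_subset_Icc_self ha) (Set.Ioo_subset_Icc_self hb) ?_
    dsimp only at hab
    linarith

theorem integral_cos_pow_odd_zero_pi (m : ℕ) :
    ∫ θ in (0 : ℝ)..π, Real.cos θ ^ (2 * m + 1) = 0 := by
  induction m with
  | zero => simp
  | succ m ih =>
    rw [show 2 * (m + 1) + 1 = (2 * m + 1) + 2 by ring, integral_cos_pow, ih]
    simp

theorem integral_cos_pow_even_zero_pi (m : ℕ) :
    ∫ θ in (0 : ℝ)..π, Real.cos θ ^ (2 * m)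
      = π * (2 * m).factorial / (4 ^ m * (m.factorial : ℝ) ^ 2) := by
  induction m with
  | zero => simp
  | succ m ih =>
    rw [show 2 * (m + 1) = 2 * m + 2 by ring, integral_cos_pow, ih]
    simp only [Nat.factorial_succ, Real.sin_pi, Real.sin_zero]
    push_cast
    field_simp
    ring

theorem hasSum_integral_exp_mul_cos (t : ℝ) :
    HasSum (fun n : ℕ => t ^ (2 * n) / (n.factorial : ℝ) ^ 2)
      ((∫ θ in (0 : ℝ)..π, Real.exp (2 * t * Real.cos θ)) / π) := by
  have key : HasSum (fun n : ℕ => ∫ θ in (0 : ℝ)..π, (2 * t * Real.cos θ) ^ n / n.factorial)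
      (∫ θ in (0 : ℝ)..π, Real.exp (2 * t * Real.cos θ)) := by
    refine intervalIntegral.hasSum_integral_of_dominated_convergence
      (fun n _ => |2 * t| ^ n / n.factorial) (fun n => ?_) (fun n => ?_) ?_ ?_ ?_
    · exact (by fun_prop : Continuous fun θ : ℝ =>
        (2 * t * Real.cos θ) ^ n / (n.factorial : ℝ)).aestronglyMeasurable
    · refine Filter.Eventually.of_forall fun θ _ => ?_
      rw [Real.norm_eq_abs, abs_div, abs_pow, Nat.abs_cast, abs_mul]
      gcongr
      exact mul_le_of_le_one_right (abs_nonneg _) (Real.abs_cos_le_one θ)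
    · exact Filter.Eventually.of_forall fun _ _ => Real.summable_pow_div_factorial _
    · exact intervalIntegrable_const
    · refine Filter.Eventually.of_forall fun θ _ => ?_
      rw [Real.exp_eq_exp_ℝ]
      exact NormedSpace.expSeries_div_hasSum_exp _
  have hint (n : ℕ) : ∫ θ in (0 : ℝ)..π, (2 * t * Real.cos θ) ^ n / n.factorial
      = (2 * t) ^ n / n.factorial * ∫ θ in (0 : ℝ)..π, Real.cos θ ^ n := by
    rw [← intervalIntegral.integral_const_mul]
    congr 1 with θ
    ring
  simp only [hint] at key
  have hinj : Function.Injective fun m : ℕ => 2 * m := mul_right_injective₀ two_ne_zero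
  rw [← hinj.hasSum_iff] at key
  · have h := key.div_const π
    refine (congrArg (HasSum · _) (funext fun m => ?_)).mpr h
    simp only [Function.comp_apply, integral_cos_pow_even_zero_pi]
    rw [mul_pow, pow_mul 2 2 m]
    field_simp
    norm_num
  · intro n hn
    obtain ⟨m, rfl | rfl⟩ := n.even_or_odd'
    · exact absurd ⟨m, rfl⟩ hn
    · rw [integral_cos_pow_odd_zero_pi, mul_zero]

/-- The heat function of `ℤ`: for every real `t`,
`∫_0^4 e^{−tx}/(π√(x(4−x))) dx = e^{−2t}·∑_{n≥0} t^{2n}/(n!)²`, the series on the right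
(which equals `I_0(2t)`) converging for all `t`. -/
theorem heat_function_Z (t : ℝ) :
    ∃ S : ℝ, HasSum (fun n : ℕ => t ^ (2 * n) / ((n.factorial : ℝ)) ^ 2) S ∧
      (∫ x in Set.Ioo (0 : ℝ) 4, Real.exp (-(t * x)) / (π * Real.sqrt (x * (4 - x))))
        = Real.exp (-(2 * t)) * S := by
  refine ⟨_, hasSum_integral_exp_mul_cos t, ?_⟩
  rw [integral_div_pi_mul_sqrt_eq_integral_cos fun x => Real.exp (-(t * x)), ← mul_div_assoc,
    ← intervalIntegral.integral_const_mul]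
  congr 2 with θ
  rw [← Real.exp_add]
  congr 1
  ring
end
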